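/- arXiv:2405.18298 — 2 statements merged into one kernel-verified Lean document; each statement's English description precedes it below -/
import Mathlib

section
/- The naive Bayes model is strictly contained in the space of naive staged tree classifiers: \mathcal{M}_{\mathcal{G}}^{naive} \subset \mathcal{M}_T^{naive}. That is, every strictly positive distribution in the naive Bayes model lies in the model of some naive staged tree classifier, and (provided p \geq 2) there exists a naive staged tree classifier whose model contains a distribution not in the naive Bayes model. -/
open Finset

section StagedTrees

variable {p : ℕ}

/-- A strictly positive probability distribution on the finite product space `∀ i, X i`. -/
def StrictlyPositiveDist {X : Fin p → Type*} [∀ i, Fintype (X i)]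
    (P : (∀ i, X i) → ℝ) : Prop :=
  (∀ x, 0 < P x) ∧ ∑ x, P x = 1

/-- The conditional probability `P(X i = a ∣ X_[i-1] = x_[i-1])`, where the prefix
`x_[i-1]` consists of the coordinates of `x` of index `< i`. -/
noncomputable def condProb {X : Fin p → Type*} [∀ i, Fintype (X i)] [∀ i, DecidableEq (X i)]
    (P : (∀ i, X i) → ℝ) (i : Fin p) (a : X i) (x : ∀ j, X j) : ℝ :=
  (∑ y ∈ univ.filter (fun y : ∀ j, X j => y i = a ∧ ∀ j, j < i → y j = x j), P y) /
    (∑ y ∈ univ.filter (fun y : ∀ j, X j => ∀ j, j < i → y j = x j), P y)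

/-- The conditional probability `P(X i = a ∣ X_A = x_A)` for a set `A` of coordinates. -/
noncomputable def condProbOn {X : Fin p → Type*} [∀ i, Fintype (X i)] [∀ i, DecidableEq (X i)]
    (P : (∀ i, X i) → ℝ) (A : Finset (Fin p)) (i : Fin p) (a : X i) (x : ∀ j, X j) : ℝ :=
  (∑ y ∈ univ.filter (fun y : ∀ j, X j => y i = a ∧ ∀ j ∈ A, y j = x j), P y) /
    (∑ y ∈ univ.filter (fun y : ∀ j, X j => ∀ j ∈ A, y j = x j), P y)

/-- A staging of the `X`-compatible staged tree: for each level `i`, a partition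
(equivalence relation) of the prefixes `x_[i-1]`, encoded as an equivalence relation on
full configurations that identifies configurations with the same prefix of length `i`
(coordinates of index `< i`). Vertices in the same class are in the same stage. -/
structure Staging (X : Fin p → Type*) where
  rel : Fin p → (∀ j, X j) → (∀ j, X j) → Prop
  equiv : ∀ i, Equivalence (rel i)
  prefix_mem : ∀ i x y, (∀ j, j < i → x j = y j) → rel i x y

/-- Membership in the staged tree model `𝓜_{T,θ}`: `P` is a strictly positive distribution and
prefixes in the same stage give equal conditional distributions for the next variable. -/
def MemStagedTreeModel {X : Fin p → Type*} [∀ i, Fintype (X i)] [∀ i, DecidableEq (X i)]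
    (σ : Staging X) (P : (∀ i, X i) → ℝ) : Prop :=
  StrictlyPositiveDist P ∧
    ∀ i x x', σ.rel i x x' → ∀ a : X i, condProb P i a x = condProb P i a x'

/-- A DAG on `{1,…,p}` compatible with the variable ordering, encoded by its parent sets:
every parent of `i` precedes `i`. -/
def OrderCompat (par : Fin p → Finset (Fin p)) : Prop :=
  ∀ i, ∀ j ∈ par i, j < i

/-- `P` is (strictly positive and) Markov to the DAG with parent sets `par`:
`P x = ∏ k P(x k ∣ x_{par k})`. -/
def MarkovTo {X : Fin p → Type*} [∀ i, Fintype (X i)] [∀ i, DecidableEq (X i)]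
    (par : Fin p → Finset (Fin p)) (P : (∀ i, X i) → ℝ) : Prop :=
  StrictlyPositiveDist P ∧ ∀ x, P x = ∏ i, condProbOn P (par i) i (x i) x

/-- `par` is the minimal DAG `G_T` of the staged tree with staging `σ`: it is order-compatible,
`𝓜_{T,θ} ⊆ 𝓜_{G_T}`, and its edge set is contained in the edge set of every order-compatible
DAG `G` with `𝓜_{T,θ} ⊆ 𝓜_G`. -/
def IsMinimalDAG {X : Fin p → Type*} [∀ i, Fintype (X i)] [∀ i, DecidableEq (X i)]
    (σ : Staging X) (par : Fin p → Finset (Fin p)) : Prop :=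
  OrderCompat par ∧ (∀ P, MemStagedTreeModel σ P → MarkovTo par P) ∧
    ∀ par', OrderCompat par' → (∀ P, MemStagedTreeModel σ P → MarkovTo par' P) →
      ∀ i, par i ⊆ par' i

/-- The number of stages at level `i` of a staging: the number of equivalence classes. -/
noncomputable def numStages {X : Fin p → Type*} (σ : Staging X) (i : Fin p) : ℕ :=
  Set.ncard {S : Set (∀ j, X j) | ∃ x, S = {y | σ.rel i x y}}

/-- In the classification setting the variables are `(C, X₁, …, X_q)` with the class `C` at
index `0`. A Bayesian network classifier: an order-compatible DAG in which `C` has no parents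
and `C` is a parent of every feature. -/
def IsBNC {q : ℕ} (par : Fin (q + 1) → Finset (Fin (q + 1))) : Prop :=
  OrderCompat par ∧ par 0 = ∅ ∧ ∀ i : Fin (q + 1), i ≠ 0 → (0 : Fin (q + 1)) ∈ par i

/-- A `k`-DB BNC: a BNC in which every feature has at most `k` feature parents. -/
def IsKDB {q : ℕ} (par : Fin (q + 1) → Finset (Fin (q + 1))) (k : ℕ) : Prop :=
  IsBNC par ∧ ∀ i, ((par i).erase 0).card ≤ k

end StagedTrees

/-- The parent sets of the naive Bayes DAG: the class (index `0`) has no parents and is the only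
parent of every feature. -/
def naiveParents (q : ℕ) : Fin (q + 1) → Finset (Fin (q + 1)) :=
  fun i => if i = 0 then ∅ else {0}

/-- A naive staged tree classifier: at every level `1 ≤ k ≤ p` the partition into stages has
exactly `|ℂ|` stages, where `ℂ` is the sample space of the class (index `0`). -/
def IsNaiveStaging {q : ℕ} {Y : Fin (q + 1) → Type*} [∀ i, Fintype (Y i)]
    (σ : Staging Y) : Prop :=
  ∀ i : Fin (q + 1), i ≠ 0 → numStages σ i = Fintype.card (Y 0)


section Kernel

variable {p : ℕ} {X : Fin p → Type*} [∀ i, Fintype (X i)] [∀ i, DecidableEq (X i)]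

/-- Summing out the last coordinates of a product of kernels. -/
lemma kernel_prefix_sum (P : (∀ i, X i) → ℝ) (f : ∀ i : Fin p, X i → (∀ j, X j) → ℝ)
    (hP : ∀ x, P x = ∏ i, f i (x i) x)
    (hdep : ∀ i a x y, (∀ j, j < i → x j = y j) → f i a x = f i a y)
    (hsum : ∀ i x, ∑ a, f i a x = 1) (d : ℕ) :
    ∀ m, m + d = p → ∀ x : ∀ j, X j,
      ∑ y ∈ univ.filter (fun y : ∀ j, X j => ∀ j : Fin p, j.val < m → y j = x j), P y
        = ∏ j ∈ univ.filter (fun j : Fin p => j.val < m), f j (x j) x := by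
  induction d with
  | zero =>
    intro m hm x
    have h1 : (univ.filter (fun y : ∀ j, X j => ∀ j : Fin p, j.val < m → y j = x j)) = {x} := by
      ext y
      simp only [mem_filter, mem_univ, true_and, mem_singleton]
      constructor
      · intro h
        funext j
        exact h j (by omega)
      · rintro rfl _ _
        rfl
    have h2 : (univ.filter (fun j : Fin p => j.val < m)) = univ := by
      ext j
      simp only [mem_filter, mem_univ, true_and, iff_true]
      omega
    rw [h1, h2, sum_singleton, hP]
  | succ d ih =>
    intro m hm x
    have hmp : m < p := by omega
    let i : Fin p := ⟨m, hmp⟩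
    rw [← sum_fiberwise (univ.filter (fun y : ∀ j, X j => ∀ j : Fin p, j.val < m → y j = x j))
      (fun y => y i) P]
    have h1 : ∀ a : X i,
        ∑ y ∈ (univ.filter (fun y : ∀ j, X j => ∀ j : Fin p, j.val < m → y j = x j)).filter
          (fun y => y i = a), P y
        = (∏ j ∈ univ.filter (fun j : Fin p => j.val < m), f j (x j) x) * f i a x := by
      intro a
      have hset : (univ.filter (fun y : ∀ j, X j => ∀ j : Fin p, j.val < m → y j = x j)).filter
          (fun y => y i = a) = univ.filter (fun y : ∀ j, X j => ∀ j : Fin p, j.val < m + 1 →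
            y j = Function.update x i a j) := by
        ext y
        simp only [mem_filter, mem_univ, true_and]
        constructor
        · rintro ⟨h, hi⟩ j hj
          by_cases hji : j = i
          · subst hji
            simpa using hi
          · rw [Function.update_of_ne hji]
            apply h
            have : j.val ≠ m := fun h => hji (Fin.ext h)
            omega
        · intro h
          refine ⟨fun j hj => ?_, ?_⟩
          · have hji : j ≠ i := by
              rintro rfl
              exact absurd hj (lt_irrefl m)
            have := h j (by omega)
            rwa [Function.update_of_ne hji] at this
          · have := h i (Nat.lt_succ_self m)
            simpa using this
      have hset2 : (univ.filter (fun j : Fin p => j.val < m + 1))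
          = insert i (univ.filter (fun j : Fin p => j.val < m)) := by
        ext j
        simp only [mem_filter, mem_univ, true_and, mem_insert, Fin.ext_iff, i]
        omega
      rw [hset, ih (m + 1) (by omega), hset2, prod_insert (by simp [i]), mul_comm]
      congr 1
      · apply prod_congr rfl
        intro j hj
        simp only [mem_filter, mem_univ, true_and] at hj
        have hji : j ≠ i := by
          rintro rfl
          exact absurd hj (lt_irrefl m)
        rw [Function.update_of_ne hji]
        apply hdep
        intro k hk
        have hki : k ≠ i := by
          rintro rfl
          have : m < j.val := hk
          omega
        rw [Function.update_of_ne hki]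
      · rw [Function.update_self]
        apply hdep
        intro k hk
        rw [Function.update_of_ne (ne_of_lt hk)]
    rw [sum_congr rfl (fun a _ => h1 a), ← mul_sum, hsum, mul_one]

lemma kernel_total (P : (∀ i, X i) → ℝ) (f : ∀ i : Fin p, X i → (∀ j, X j) → ℝ)
    (hP : ∀ x, P x = ∏ i, f i (x i) x)
    (hdep : ∀ i a x y, (∀ j, j < i → x j = y j) → f i a x = f i a y)
    (hsum : ∀ i x, ∑ a, f i a x = 1) (x : ∀ j, X j) : ∑ y, P y = 1 := by
  have := kernel_prefix_sum P f hP hdep hsum p 0 (by omega) x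
  simpa using this

lemma kernel_condProb (P : (∀ i, X i) → ℝ) (f : ∀ i : Fin p, X i → (∀ j, X j) → ℝ)
    (hP : ∀ x, P x = ∏ i, f i (x i) x)
    (hdep : ∀ i a x y, (∀ j, j < i → x j = y j) → f i a x = f i a y)
    (hsum : ∀ i x, ∑ a, f i a x = 1) (hpos : ∀ x, 0 < P x)
    (i : Fin p) (a : X i) (x : ∀ j, X j) : condProb P i a x = f i a x := by
  unfold condProb
  have hden := kernel_prefix_sum P f hP hdep hsum (p - i.val) i.val (by omega) x
  have hnum := kernel_prefix_sum P f hP hdep hsum (p - (i.val + 1)) (i.val + 1) (by omega)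
    (Function.update x i a)
  have hset2 : (univ.filter (fun j : Fin p => j.val < i.val + 1))
      = insert i (univ.filter (fun j : Fin p => j.val < i.val)) := by
    ext j
    simp only [mem_filter, mem_univ, true_and, mem_insert, Fin.ext_iff]
    omega
  rw [hset2, prod_insert (by simp)] at hnum
  have hprod : ∏ j ∈ univ.filter (fun j : Fin p => j.val < i.val),
      f j (Function.update x i a j) (Function.update x i a)
      = ∏ j ∈ univ.filter (fun j : Fin p => j.val < i.val), f j (x j) x := by
    apply prod_congr rfl
    intro j hj
    simp only [mem_filter, mem_univ, true_and] at hj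
    have hji : j < i := hj
    rw [Function.update_of_ne (ne_of_lt hji)]
    apply hdep
    intro k hk
    rw [Function.update_of_ne (ne_of_lt (hk.trans hji))]
  have hfi : f i (Function.update x i a i) (Function.update x i a) = f i a x := by
    rw [Function.update_self]
    apply hdep
    intro k hk
    rw [Function.update_of_ne (ne_of_lt hk)]
  rw [hprod, hfi] at hnum
  have hset : univ.filter (fun y : ∀ j, X j => y i = a ∧ ∀ j, j < i → y j = x j)
      = univ.filter (fun y : ∀ j, X j => ∀ j : Fin p, j.val < i.val + 1 →
        y j = Function.update x i a j) := by
    ext y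
    simp only [mem_filter, mem_univ, true_and]
    constructor
    · rintro ⟨hi, h⟩ j hj
      by_cases hji : j = i
      · subst hji
        simpa using hi
      · rw [Function.update_of_ne hji]
        exact h j (lt_of_le_of_ne (Nat.lt_succ_iff.mp hj) hji)
    · intro h
      refine ⟨?_, fun j hj => ?_⟩
      · simpa using h i (Nat.lt_succ_self _)
      · have := h j (Nat.lt_succ_of_lt hj)
        rwa [Function.update_of_ne (ne_of_lt hj)] at this
  have hset' : univ.filter (fun y : ∀ j, X j => ∀ j, j < i → y j = x j)
      = univ.filter (fun y : ∀ j, X j => ∀ j : Fin p, j.val < i.val → y j = x j) := rfl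
  have hdpos : 0 < ∑ y ∈ univ.filter
      (fun y : ∀ j, X j => ∀ j : Fin p, j.val < i.val → y j = x j), P y :=
    sum_pos (fun y _ => hpos y) ⟨x, by simp⟩
  rw [hset, hset', hnum]
  rw [hden] at hdpos ⊢
  field_simp

lemma markov_condProb (par : Fin p → Finset (Fin p)) (hpar : OrderCompat par)
    (P : (∀ i, X i) → ℝ) (h : MarkovTo par P) (i : Fin p) (a : X i) (x : ∀ j, X j) :
    condProb P i a x = condProbOn P (par i) i a x := by
  refine kernel_condProb P (fun i a x => condProbOn P (par i) i a x) h.2 ?_ ?_ h.1.1 i a x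
  · intro i a x y hxy
    have h1 : ∀ y' : ∀ j, X j, (∀ j ∈ par i, y' j = x j) ↔ (∀ j ∈ par i, y' j = y j) := by
      intro y'
      refine forall₂_congr fun j hj => ?_
      rw [hxy j (hpar i j hj)]
    simp only [condProbOn, h1]
  · intro i x
    have hdpos : 0 < ∑ y ∈ univ.filter (fun y : ∀ j, X j => ∀ j ∈ par i, y j = x j), P y :=
      sum_pos (fun y _ => h.1.1 y) ⟨x, by simp⟩
    simp only [condProbOn]
    rw [← sum_div, div_eq_one_iff_eq hdpos.ne']
    rw [← sum_fiberwise (univ.filter (fun y : ∀ j, X j => ∀ j ∈ par i, y j = x j))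
      (fun y => y i) P]
    refine sum_congr rfl fun a _ => sum_congr ?_ fun _ _ => rfl
    ext y
    simp [and_comm]

end Kernel

section Naive

variable {q : ℕ} {Y : Fin (q + 1) → Type*} [∀ i, Fintype (Y i)] [∀ i, DecidableEq (Y i)]

lemma naive_orderCompat : OrderCompat (naiveParents q) := by
  intro i j hj
  unfold naiveParents at hj
  split_ifs at hj with h
  · simp at hj
  · rw [mem_singleton] at hj
    subst hj
    exact Fin.pos_of_ne_zero h

lemma naive_condProb_congr (P : (∀ i, Y i) → ℝ) (h : MarkovTo (naiveParents q) P)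
    (i : Fin (q + 1)) (a : Y i) (x x' : ∀ j, Y j) (hx : i = 0 ∨ x 0 = x' 0) :
    condProb P i a x = condProb P i a x' := by
  rw [markov_condProb _ naive_orderCompat P h, markov_condProb _ naive_orderCompat P h]
  by_cases hi : i = 0
  · simp [condProbOn, naiveParents, hi]
  · have := hx.resolve_left hi
    simp [condProbOn, naiveParents, hi, this]

/-- The staging induced by a stage-labelling function. -/
def stagingOf (s : Fin (q + 1) → (∀ j, Y j) → Y 0)
    (hs : ∀ i, i ≠ 0 → ∀ x y : (∀ j, Y j), (∀ j, j < i → x j = y j) → s i x = s i y) :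
    Staging Y where
  rel i x y := i = 0 ∨ s i x = s i y
  equiv i := ⟨fun _ => Or.inr rfl, fun h => h.imp_right Eq.symm, fun h h' => by
    rcases h with h | h
    · exact Or.inl h
    · exact h'.imp_right h.trans⟩
  prefix_mem i x y h := by
    by_cases hi : i = 0
    · exact Or.inl hi
    · exact Or.inr (hs i hi x y h)

lemma stagingOf_naive (s : Fin (q + 1) → (∀ j, Y j) → Y 0)
    (hs : ∀ i, i ≠ 0 → ∀ x y : (∀ j, Y j), (∀ j, j < i → x j = y j) → s i x = s i y)
    (hsurj : ∀ i, i ≠ 0 → Function.Surjective (s i)) : IsNaiveStaging (stagingOf s hs) := by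
  intro i hi
  unfold numStages
  have h1 : {S : Set (∀ j, Y j) | ∃ x, S = {y | (stagingOf s hs).rel i x y}}
      = Set.range (fun c : Y 0 => {y | c = s i y}) := by
    ext S
    simp only [Set.mem_setOf_eq, Set.mem_range, stagingOf, hi, false_or]
    constructor
    · rintro ⟨x, rfl⟩
      exact ⟨s i x, rfl⟩
    · rintro ⟨c, rfl⟩
      obtain ⟨x, rfl⟩ := hsurj i hi c
      exact ⟨x, rfl⟩
  have hinj : Function.Injective (fun c : Y 0 => {y | c = s i y}) := by
    intro c c' h
    obtain ⟨x, rfl⟩ := hsurj i hi c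
    have : x ∈ {y | s i x = s i y} := rfl
    simp only at h
    rw [h] at this
    exact Eq.symm this
  rw [h1, ← Set.image_univ, Set.ncard_image_of_injective _ hinj, Set.ncard_univ,
    Nat.card_eq_fintype_card]

end Naive

/-- `𝓜_𝓖^naive ⊂ 𝓜_T^naive`: every strictly positive distribution in the naive
Bayes model (features conditionally independent given the class) lies in the model of some naive
staged tree classifier, and (provided `p ≥ 2`) some naive staged tree classifier contains a
distribution not in the naive Bayes model. -/
theorem naive_bayes_strict_subset_naive_staged_trees {q : ℕ} (Y : Fin (q + 1) → Type*)
    [∀ i, Fintype (Y i)] [∀ i, DecidableEq (Y i)]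
    (hcard : ∀ i, 2 ≤ Fintype.card (Y i)) :
    (∀ P : (∀ i, Y i) → ℝ, MarkovTo (naiveParents q) P →
      ∃ σ : Staging Y, IsNaiveStaging σ ∧ MemStagedTreeModel σ P) ∧
    (2 ≤ q → ∃ σ : Staging Y, IsNaiveStaging σ ∧
      ∃ P : (∀ i, Y i) → ℝ, MemStagedTreeModel σ P ∧ ¬ MarkovTo (naiveParents q) P) := by
  have hne : ∀ i, Nonempty (Y i) := fun i => Fintype.card_pos_iff.mp (by have := hcard i; omega)
  have e : ∀ i, Y i := fun i => (hne i).some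
  constructor
  · intro P hP
    refine ⟨stagingOf (fun _ x => x 0) (fun i hi x y h => h 0 (Fin.pos_of_ne_zero hi)),
      stagingOf_naive _ _ ?_, hP.1, ?_⟩
    · intro i hi c
      exact ⟨Function.update e 0 c, by simp⟩
    · intro i x x' h a
      exact naive_condProb_congr P hP i a x x' h
  · intro hq
    let i1 : Fin (q + 1) := ⟨1, by omega⟩
    let i2 : Fin (q + 1) := ⟨2, by omega⟩
    have h10 : i1 ≠ 0 := by simp [i1, Fin.ext_iff]
    have h20 : i2 ≠ 0 := by simp [i2, Fin.ext_iff]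
    have h12 : i1 < i2 := by simp [i1, i2]
    obtain ⟨c1, hc1⟩ : ∃ c, c ≠ e 0 :=
      @exists_ne _ (Fintype.one_lt_card_iff_nontrivial.mp (hcard 0)) (e 0)
    obtain ⟨b1, hb1⟩ : ∃ b, b ≠ e i1 :=
      @exists_ne _ (Fintype.one_lt_card_iff_nontrivial.mp (hcard i1)) (e i1)
    let s : Fin (q + 1) → (∀ j, Y j) → Y 0 := fun i x =>
      if i = i2 ∧ x i1 ≠ e i1 then Equiv.swap (e 0) c1 (x 0) else x 0
    have hs : ∀ i, i ≠ 0 → ∀ x y : (∀ j, Y j), (∀ j, j < i → x j = y j) → s i x = s i y := by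
      intro i hi x y h
      have h0 := h 0 (Fin.pos_of_ne_zero hi)
      by_cases hi2 : i = i2
      · subst hi2
        simp only [s, h0, h i1 h12]
      · simp [s, hi2, h0]
    have hsurj : ∀ i, i ≠ 0 → Function.Surjective (s i) := by
      intro i hi c
      refine ⟨Function.update e 0 c, ?_⟩
      simp [s, Function.update_of_ne h10]
    let f : ∀ i : Fin (q + 1), Y i → (∀ j, Y j) → ℝ := fun i a x =>
      if i = i2 ∧ s i x = e 0 then (if a = e i then 2 else 1) / ((Fintype.card (Y i) : ℝ) + 1)
      else 1 / (Fintype.card (Y i) : ℝ)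
    have hcpos : ∀ i, (0 : ℝ) < Fintype.card (Y i) := fun i => by
      have := hcard i
      exact_mod_cast (by omega : 0 < Fintype.card (Y i))
    have hfpos : ∀ i a x, 0 < f i a x := by
      intro i a x
      have := hcpos i
      simp only [f]
      split_ifs <;> positivity
    have hstage : ∀ i a x y, (i = 0 ∨ s i x = s i y) → f i a x = f i a y := by
      intro i a x y h
      rcases h with h | h
      · subst h
        simp [f, h20.symm]
      · simp only [f, h]
    have hdep : ∀ i a x y, (∀ j, j < i → x j = y j) → f i a x = f i a y := by
      intro i a x y h
      apply hstage
      by_cases hi : i = 0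
      · exact Or.inl hi
      · exact Or.inr (hs i hi x y h)
    have hsum : ∀ i x, ∑ a, f i a x = 1 := by
      intro i x
      have hc := hcpos i
      by_cases h : i = i2 ∧ s i x = e 0
      · simp only [f, if_pos h]
        rw [← sum_div, div_eq_one_iff_eq (by positivity)]
        have : ∀ a : Y i, (if a = e i then (2 : ℝ) else 1) = 1 + if a = e i then 1 else 0 := by
          intro a
          split_ifs <;> norm_num
        simp [this, sum_add_distrib]
      · simp only [f, if_neg h]
        simp [hc.ne']
    let P : (∀ i, Y i) → ℝ := fun x => ∏ i, f i (x i) x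
    have hPpos : ∀ x, 0 < P x := fun x => prod_pos fun i _ => hfpos i _ x
    have hcond := kernel_condProb P f (fun _ => rfl) hdep hsum hPpos
    refine ⟨stagingOf s hs, stagingOf_naive s hs hsurj, P,
      ⟨⟨hPpos, kernel_total P f (fun _ => rfl) hdep hsum e⟩, ?_⟩, ?_⟩
    · intro i x x' h a
      rw [hcond, hcond]
      exact hstage i a x x' h
    · intro hM
      have key := naive_condProb_congr P hM i2 (e i2) e (Function.update e i1 b1)
        (Or.inr (by rw [Function.update_of_ne h10.symm]))
      rw [hcond, hcond] at key
      have hs1 : s i2 e = e 0 := by simp [s]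
      have hs2 : s i2 (Function.update e i1 b1) ≠ e 0 := by
        simp [s, hb1, Function.update_of_ne h10.symm, hc1]
      simp only [f, hs1, hs2, and_true, and_false, if_true, if_false] at key
      have hc := hcpos i2
      have hc2 : (2 : ℝ) ≤ Fintype.card (Y i2) := by exact_mod_cast hcard i2
      rw [div_eq_div_iff (by positivity) (by positivity)] at key
      linarith
end

section
/- Naive staged tree classifiers are not necessarily 1-parent staged trees: there exists a naive staged tree classifier T (e.g., over a binary class and two binary features) whose minimal DAG G_T is the complete DAG on (C, X_1, X_2); in particular the maximal in-degree of G_T exceeds 1. -/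
open Finset

/-- Stage label at level `i`: constant, the class, and the xor of class and first feature. -/
def stageLabel (i : Fin (2 + 1)) (x : Fin (2 + 1) → Bool) : Bool :=
  if i = 0 then false else if i = 1 then x 0 else xor (x 0) (x 1)

/-- The xor staging. -/
def xorStaging : Staging (fun _ : Fin (2 + 1) => Bool) where
  rel i x y := stageLabel i x = stageLabel i y
  equiv i := ⟨fun _ => rfl, fun h => h.symm, fun h h' => h.trans h'⟩
  prefix_mem i x y h := by
    fin_cases i
    · simp [stageLabel]
    · simpa [stageLabel] using h 0 (by decide)
    · have h0 := h 0 (by decide)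
      have h1 := h 1 (by decide)
      simp [stageLabel, h0, h1]

/-- A member of the model. -/
noncomputable def xorDist (x : Fin (2 + 1) → Bool) : ℝ :=
  1 / 2 * (if x 1 = x 0 then 2 / 3 else 1 / 3) * (if x 2 = xor (x 0) (x 1) then 2 / 3 else 1 / 3)

theorem vec_two (a b c : Bool) : (![a, b, c] : Fin (2 + 1) → Bool) 2 = c := rfl

theorem sum_bool3 (g : (Fin (2 + 1) → Bool) → ℝ) :
    ∑ y, g y = g ![false, false, false] + g ![false, false, true] + g ![false, true, false]
      + g ![false, true, true] + g ![true, false, false] + g ![true, false, true]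
      + g ![true, true, false] + g ![true, true, true] := by
  have h : (univ : Finset (Fin (2 + 1) → Bool)) = {![false, false, false], ![false, false, true],
      ![false, true, false], ![false, true, true], ![true, false, false], ![true, false, true],
      ![true, true, false], ![true, true, true]} := by decide
  rw [h]
  repeat rw [Finset.sum_insert (by decide)]
  rw [Finset.sum_singleton]
  ring

theorem forall_bool3 {q : (Fin (2 + 1) → Bool) → Prop} (h : ∀ a b c, q ![a, b, c]) (x) : q x := by
  have : x = ![x 0, x 1, x 2] := by ext i; fin_cases i <;> rfl
  rw [this]; exact h _ _ _

theorem numStages_xor (i : Fin (2 + 1)) (hi : i ≠ 0) : numStages xorStaging i = 2 := by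
  have hs : ∀ b, ∃ x, stageLabel i x = b := by
    intro b
    refine ⟨![b, false, false], ?_⟩
    fin_cases i
    · simp at hi
    · simp [stageLabel]
    · simp [stageLabel]
  unfold numStages
  have : {S : Set (Fin (2 + 1) → Bool) | ∃ x, S = {y | xorStaging.rel i x y}} =
      {{y | false = stageLabel i y}, {y | true = stageLabel i y}} := by
    ext S
    simp only [Set.mem_ofPred_eq, Set.mem_insert_iff, Set.mem_singleton_iff, xorStaging]
    constructor
    · rintro ⟨x, rfl⟩
      cases stageLabel i x
      · exact Or.inl rfl
      · exact Or.inr rfl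
    · rintro (rfl | rfl)
      · obtain ⟨x, hx⟩ := hs false
        exact ⟨x, by rw [hx]⟩
      · obtain ⟨x, hx⟩ := hs true
        exact ⟨x, by rw [hx]⟩
  rw [this]
  apply Set.ncard_pair
  intro h
  obtain ⟨x, hx⟩ := hs false
  have h1 : x ∈ {y | false = stageLabel i y} := hx.symm
  rw [h] at h1
  exact absurd (h1.trans hx) (by decide)

theorem xorDist_pos : StrictlyPositiveDist xorDist := by
  constructor
  · intro x
    unfold xorDist
    split_ifs <;> norm_num
  · rw [sum_bool3]
    norm_num [vec_two, xorDist]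

theorem condProb_xor (i : Fin (2 + 1)) (a : Bool) (x : Fin (2 + 1) → Bool) :
    condProb (X := fun _ => Bool) xorDist i a x =
      if i = 0 then 1 / 2 else if a = stageLabel i x then 2 / 3 else 1 / 3 := by
  revert x
  apply forall_bool3
  intro b c d
  unfold condProb
  rw [Finset.sum_filter, Finset.sum_filter, sum_bool3, sum_bool3]
  fin_cases i <;> cases a <;> cases b <;> cases c <;>
    norm_num [vec_two, xorDist, stageLabel, Fin.forall_fin_succ, Fin.lt_def]

theorem xorDist_mem : MemStagedTreeModel xorStaging xorDist := by
  refine ⟨xorDist_pos, fun i x x' h a => ?_⟩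
  rw [condProb_xor, condProb_xor]
  have h' : stageLabel i x = stageLabel i x' := h
  rw [h']

theorem markov_complete (P : (Fin (2 + 1) → Bool) → ℝ)
    (hP : StrictlyPositiveDist (X := fun _ => Bool) P) :
    MarkovTo (X := fun _ => Bool) (fun i : Fin (2 + 1) => Finset.Iio i) P := by
  refine ⟨hP, ?_⟩
  obtain ⟨hp, hs⟩ := hP
  intro x
  have e0 : ∑ y ∈ univ.filter (fun y : Fin (2 + 1) → Bool => ∀ j ∈ Finset.Iio (0 : Fin (2 + 1)),
      y j = x j), P y = 1 := by
    rw [← hs]; congr 1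
  have e1 : univ.filter (fun y : Fin (2 + 1) → Bool => y 0 = x 0 ∧
      ∀ j ∈ Finset.Iio (0 : Fin (2 + 1)), y j = x j) = univ.filter (fun y : Fin (2 + 1) → Bool =>
      ∀ j ∈ Finset.Iio (1 : Fin (2 + 1)), y j = x j) := by
    ext y; simp [Fin.forall_fin_succ, Fin.lt_def]
  have e2 : univ.filter (fun y : Fin (2 + 1) → Bool => y 1 = x 1 ∧
      ∀ j ∈ Finset.Iio (1 : Fin (2 + 1)), y j = x j) = univ.filter (fun y : Fin (2 + 1) → Bool =>
      ∀ j ∈ Finset.Iio (2 : Fin (2 + 1)), y j = x j) := by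
    ext y; simp [Fin.forall_fin_succ, Fin.lt_def] <;> tauto
  have e3 : univ.filter (fun y : Fin (2 + 1) → Bool => y 2 = x 2 ∧
      ∀ j ∈ Finset.Iio (2 : Fin (2 + 1)), y j = x j) = {x} := by
    ext y; simp [Fin.forall_fin_succ, Fin.lt_def, funext_iff]; tauto
  have hpos : ∀ i : Fin (2 + 1), (∑ y ∈ univ.filter (fun y : Fin (2 + 1) → Bool =>
      ∀ j ∈ Finset.Iio i, y j = x j), P y) ≠ 0 := by
    intro i
    apply ne_of_gt
    exact Finset.sum_pos (fun y _ => hp y) ⟨x, by simp⟩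
  have h1 := hpos 1
  have h2 := hpos 2
  rw [Fin.prod_univ_three]
  unfold condProbOn
  rw [e0, e1, e2, e3, Finset.sum_singleton]
  field_simp

theorem complete_of_markov (par : Fin (2 + 1) → Finset (Fin (2 + 1))) (ho : OrderCompat par)
    (h : MarkovTo (X := fun _ => Bool) par xorDist) (i : Fin (2 + 1)) :
    Finset.Iio i ⊆ par i := by
  have c0 : ∀ s : Finset (Fin (2 + 1)), (∀ j ∈ s, j < 0) → s = ∅ := by decide
  have c1 : ∀ s : Finset (Fin (2 + 1)), (∀ j ∈ s, j < 1) → s = ∅ ∨ s = {0} := by decide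
  have c2 : ∀ s : Finset (Fin (2 + 1)), (∀ j ∈ s, j < 2) →
      s = ∅ ∨ s = {0} ∨ s = {1} ∨ s = {0, 1} := by decide
  have h0 := c0 _ (ho 0)
  have h1 := c1 _ (ho 1)
  have h2 := c2 _ (ho 2)
  have hx := h.2 ![false, false, false]
  rw [Fin.prod_univ_three, h0] at hx
  unfold condProbOn at hx
  simp only [Finset.sum_filter, sum_bool3] at hx
  have key : par 1 = {0} ∧ par 2 = {0, 1} := by
    rcases h1 with h1 | h1 <;> rcases h2 with h2 | h2 | h2 | h2 <;> rw [h1, h2] at hx <;>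
      first
      | exact ⟨h1, h2⟩
      | (exfalso; norm_num [vec_two, xorDist] at hx)
  fin_cases i
  · intro j hj; simp at hj
  · show Finset.Iio 1 ⊆ par 1
    rw [key.1]; decide
  · show Finset.Iio 2 ⊆ par 2
    rw [key.2]; decide

/-- naive staged tree classifiers are not necessarily 1-parent staged trees:
there is a naive staged tree classifier over a binary class (index `0`) and two binary features
whose minimal DAG `G_T` is the complete DAG on `(C, X₁, X₂)`; in particular its maximal
in-degree exceeds `1`. -/
theorem naive_staged_tree_not_one_parent :
    ∃ (σ : Staging (fun _ : Fin (2 + 1) => Bool))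
      (par : Fin (2 + 1) → Finset (Fin (2 + 1))),
      (∀ i : Fin (2 + 1), i ≠ 0 → numStages σ i = 2) ∧
      IsMinimalDAG σ par ∧
      (∀ i, par i = Finset.Iio i) ∧
      (∃ i, 1 < (par i).card) := by
  refine ⟨xorStaging, fun i => Finset.Iio i, numStages_xor, ⟨?_, ?_, ?_⟩, fun _ => rfl, 2, by decide⟩
  · intro i j hj
    exact Finset.mem_Iio.1 hj
  · intro P hP
    exact markov_complete P hP.1
  · intro par' ho h i
    exact complete_of_markov par' ho (h _ xorDist_mem) i
end
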